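/- Assume R is right semihereditary and the class of s-torsion left R-modules is nontrivial. Let M, N be s-torsion K^{s-Tor}-pure-injective modules. If there exist a pure embedding f: M → N and a pure embedding g: N → M, then M and N are isomorphic. -/

import Mathlib

/- Core notions: pp-formulas, low formulas, s-torsion modules, pure embeddings. -/

universe u

open Cardinal

/-- A positive primitive (pp) formula in `n` free variables over the ring `R`:
an existentially quantified finite system of linear equations.  It is given by the
number of existentially quantified variables, the number of equations, and the
matrices of coefficients of the free and of the existentially quantified variables. -/
structure PPFormula (R : Type u) [Ring R] (n : ℕ) : Type u where
  nExist : ℕ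
  nEq : ℕ
  coeffFree : Fin nEq → Fin n → R
  coeffExist : Fin nEq → Fin nExist → R

/-- Satisfaction of a pp-formula by a tuple in a module. -/
def PPFormula.Sat {R : Type u} [Ring R] {n : ℕ} (φ : PPFormula R n)
    (M : Type u) [AddCommGroup M] [Module R M] (x : Fin n → M) : Prop :=
  ∃ y : Fin φ.nExist → M,
    ∀ i : Fin φ.nEq,
      (∑ j, φ.coeffFree i j • x j) + (∑ j, φ.coeffExist i j • y j) = 0

/-- The solution set of a pp-formula in one free variable in a module. -/
def PPFormula.solSet {R : Type u} [Ring R] (φ : PPFormula R 1)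
    (M : Type u) [AddCommGroup M] [Module R M] : Set M :=
  {m | φ.Sat M fun _ => m}

/-- A pp-formula `ψ(x)` in one free variable is low if `ψ[R] = 0`, i.e. `0` is the only
element of the left regular module `R` satisfying it. -/
def PPFormula.IsLow {R : Type u} [Ring R] (φ : PPFormula R 1) : Prop :=
  ∀ r : R, φ.Sat R (fun _ => r) → r = 0

/-- `sSet R M` is the set of elements of `M` satisfying some low pp-formula;
this is Martsinkovsky-Russell's radical `𝔰(M)`. -/
def sSet (R : Type u) [Ring R] (M : Type u) [AddCommGroup M] [Module R M] : Set M :=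
  {m | ∃ φ : PPFormula R 1, φ.IsLow ∧ φ.Sat M fun _ => m}

/-- A module is `𝔰`-torsion if every element satisfies some low pp-formula. -/
def IsSTorsion (R : Type u) [Ring R] (M : Type u) [AddCommGroup M] [Module R M] : Prop :=
  ∀ m : M, m ∈ sSet R M

/-- A linear map is a pure embedding if it is injective and pp-formulas are
reflected: any tuple whose image satisfies a pp-formula already satisfies it. -/
def IsPureEmb {R : Type u} [Ring R] {M N : Type u} [AddCommGroup M] [Module R M]
    [AddCommGroup N] [Module R N] (f : M →ₗ[R] N) : Prop :=
  Function.Injective f ∧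
    ∀ (k : ℕ) (φ : PPFormula R k) (x : Fin k → M), φ.Sat N (⇑f ∘ x) → φ.Sat M x

/-- `M` is a `K^{𝔰-Tor}`-pure-injective module: it is `𝔰`-torsion and any homomorphism
from an `𝔰`-torsion module to `M` extends along any pure embedding between `𝔰`-torsion
modules. -/
def IsKsTorPureInjective (R : Type u) [Ring R] (M : Type u)
    [AddCommGroup M] [Module R M] : Prop :=
  IsSTorsion R M ∧
    ∀ (N₁ N₂ : Type u) [AddCommGroup N₁] [Module R N₁] [AddCommGroup N₂] [Module R N₂],
      IsSTorsion R N₁ → IsSTorsion R N₂ →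
        ∀ (g : N₁ →ₗ[R] N₂), IsPureEmb g →
          ∀ f : N₁ →ₗ[R] M, ∃ h : N₂ →ₗ[R] M, h.comp g = f

/-- `M` is `Σ`-`K^{𝔰-Tor}`-pure-injective: every direct sum of copies of `M` is
`K^{𝔰-Tor}`-pure-injective. -/
def IsSigmaKsTorPureInjective (R : Type u) [Ring R] (M : Type u)
    [AddCommGroup M] [Module R M] : Prop :=
  ∀ I : Type u, IsKsTorPureInjective R (DirectSum I fun _ => M)

/-- `M` has the low-pp descending chain condition. -/
def LowPPDCC (R : Type u) [Ring R] (M : Type u) [AddCommGroup M] [Module R M] : Prop :=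
  ∀ φ : ℕ → PPFormula R 1, (φ 0).IsLow →
    (∀ n : ℕ, (φ (n + 1)).solSet M ⊆ (φ n).solSet M) →
      ∃ n₀ : ℕ, ∀ k : ℕ, n₀ ≤ k → (φ n₀).solSet M = (φ k).solSet M

/-- The class of `𝔰`-torsion left `R`-modules is nontrivial. -/
def KsTorNontrivial (R : Type u) [Ring R] : Prop :=
  ∃ (M : Type u) (_ : AddCommGroup M) (_ : Module R M), IsSTorsion R M ∧ Nontrivial M

/-- `R` is right semihereditary: every finitely generated submodule of a projective
right `R`-module (i.e. left `Rᵐᵒᵖ`-module) is projective. -/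
def RightSemihereditary (R : Type u) [Ring R] : Prop :=
  ∀ (P : Type u) [AddCommGroup P] [Module Rᵐᵒᵖ P], Module.Projective Rᵐᵒᵖ P →
    ∀ N : Submodule Rᵐᵒᵖ P, N.FG → Module.Projective Rᵐᵒᵖ ↥N

/-- Equality of the pp-types of `b₁` over `M` in `N₁` and of `b₂` over `M` in `N₂`,
where `M` is embedded in `N₁`, `N₂` via `i₁`, `i₂`. -/
def PPTypeEq (R : Type u) [Ring R] (n : ℕ) (M N₁ N₂ : Type u)
    [AddCommGroup M] [Module R M] [AddCommGroup N₁] [Module R N₁]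
    [AddCommGroup N₂] [Module R N₂]
    (i₁ : M →ₗ[R] N₁) (i₂ : M →ₗ[R] N₂) (b₁ : Fin n → N₁) (b₂ : Fin n → N₂) : Prop :=
  ∀ (l : ℕ) (φ : PPFormula R (n + l)) (a : Fin l → M),
    φ.Sat N₁ (Fin.append b₁ (⇑i₁ ∘ a)) ↔ φ.Sat N₂ (Fin.append b₂ (⇑i₂ ∘ a))

section KsTorAux

/-- A pp-formula in one variable, from a system indexed by arbitrary finite types. -/
theorem exists_ppFormula_of_system (R : Type u) [Ring R] (α β : Type) [Fintype α] [Fintype β]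
    (a : α → R) (b : α → β → R) :
    ∃ φ : PPFormula R 1, ∀ (M : Type u) [AddCommGroup M] [Module R M] (m : M),
      φ.Sat M (fun _ => m) ↔ ∃ y : β → M, ∀ i, a i • m + ∑ j, b i j • y j = 0 := by
  classical
  let eα := Fintype.equivFin α
  let eβ := Fintype.equivFin β
  refine ⟨⟨Fintype.card β, Fintype.card α, fun i _ => a (eα.symm i),
    fun i j => b (eα.symm i) (eβ.symm j)⟩, ?_⟩
  intro M _ _ m
  constructor
  · rintro ⟨y, hy⟩
    refine ⟨fun j => y (eβ j), fun i => ?_⟩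
    have := hy (eα i)
    simp only [Finset.univ_unique, Finset.sum_singleton, Equiv.symm_apply_apply] at this
    rw [← this]
    congr 1
    exact Fintype.sum_equiv eβ _ _ (fun j => by simp)
  · rintro ⟨y, hy⟩
    refine ⟨fun j => y (eβ.symm j), fun i => ?_⟩
    have := hy (eα.symm i)
    simp only [Finset.univ_unique, Finset.sum_singleton]
    rw [← this]
    congr 1
    exact Fintype.sum_equiv eβ.symm _ _ (fun j => by simp)

variable {R : Type u} [Ring R]

theorem ppSat_map {M N : Type u} [AddCommGroup M] [Module R M]
    [AddCommGroup N] [Module R N] {n : ℕ} {φ : PPFormula R n} {x : Fin n → M}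
    (f : M →ₗ[R] N) (h : φ.Sat M x) : φ.Sat N (⇑f ∘ x) := by
  obtain ⟨y, hy⟩ := h
  refine ⟨⇑f ∘ y, fun i => ?_⟩
  have := congrArg f (hy i)
  simpa [map_sum] using this

theorem sSet_map {M N : Type u} [AddCommGroup M] [Module R M]
    [AddCommGroup N] [Module R N] (f : M →ₗ[R] N) {m : M} (h : m ∈ sSet R M) :
    f m ∈ sSet R N := by
  obtain ⟨φ, hφ, hs⟩ := h
  exact ⟨φ, hφ, ppSat_map f hs⟩

theorem sSet_add {M : Type u} [AddCommGroup M] [Module R M] {m n : M}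
    (hm : m ∈ sSet R M) (hn : n ∈ sSet R M) : m + n ∈ sSet R M := by
  obtain ⟨φ, hφ, y, hy⟩ := hm
  obtain ⟨ψ, hψ, z, hz⟩ := hn
  obtain ⟨χ, hχ⟩ := exists_ppFormula_of_system R (Fin φ.nEq ⊕ Fin ψ.nEq)
    (Unit ⊕ (Fin φ.nExist ⊕ Fin ψ.nExist))
    (Sum.elim (fun _ => 0) (fun i => ψ.coeffFree i 0))
    (Sum.elim
      (fun i => Sum.elim (fun _ => φ.coeffFree i 0)
        (Sum.elim (fun j => φ.coeffExist i j) (fun _ => 0)))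
      (fun i => Sum.elim (fun _ => - ψ.coeffFree i 0)
        (Sum.elim (fun _ => 0) (fun j => ψ.coeffExist i j))))
  refine ⟨χ, ?_, ?_⟩
  · intro r hr
    obtain ⟨w, hw⟩ := (hχ R r).1 hr
    have h1 : w (Sum.inl ()) = 0 := by
      apply hφ
      refine ⟨fun j => w (Sum.inr (Sum.inl j)), fun i => ?_⟩
      have := hw (Sum.inl i)
      simpa using this
    have h2 : r - w (Sum.inl ()) = 0 := by
      apply hψ
      refine ⟨fun j => w (Sum.inr (Sum.inr j)), fun i => ?_⟩
      have := hw (Sum.inr i)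
      simp at this
      simp only [Finset.univ_unique, Finset.sum_singleton, smul_eq_mul, mul_sub, sub_eq_add_neg]
      simpa [add_assoc, mul_add] using this
    rw [h1, sub_zero] at h2
    exact h2
  · refine (hχ M _).2 ⟨Sum.elim (fun _ => m) (Sum.elim y z), ?_⟩
    rintro (i | i)
    · have := hy i
      simpa using this
    · have := hz i
      simp at this
      simp [smul_add]
      rw [← this]
      abel

theorem sSet_zero {M : Type u} [AddCommGroup M] [Module R M] (h : IsSTorsion R M)
    {N : Type u} [AddCommGroup N] [Module R N] : (0 : N) ∈ sSet R N := by
  have := sSet_map (0 : M →ₗ[R] N) (h 0)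
  simpa using this

theorem isSTorsion_of_surjective {M N : Type u} [AddCommGroup M] [Module R M]
    [AddCommGroup N] [Module R N] (h : IsSTorsion R M) (f : M →ₗ[R] N)
    (hf : Function.Surjective f) : IsSTorsion R N := by
  intro n
  obtain ⟨m, rfl⟩ := hf n
  exact sSet_map f (h m)

theorem isSTorsion_prod {M N : Type u} [AddCommGroup M] [Module R M]
    [AddCommGroup N] [Module R N] (h : IsSTorsion R M) (h' : IsSTorsion R N) :
    IsSTorsion R (M × N) := by
  rintro ⟨a, b⟩
  have := sSet_add (sSet_map (LinearMap.inl R M N) (h a)) (sSet_map (LinearMap.inr R M N) (h' b))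
  simpa using this

theorem isSTorsion_finsupp {M : Type u} [AddCommGroup M] [Module R M] (h : IsSTorsion R M)
    (I : Type u) : IsSTorsion R (I →₀ M) := by
  intro x
  induction x using Finsupp.induction_linear with
  | zero => exact sSet_zero h
  | add a b ha hb => exact sSet_add ha hb
  | single i m => exact sSet_map (Finsupp.lsingle i) (h m)

theorem isSTorsion_finsupp_nat {M : Type u} [AddCommGroup M] [Module R M] (h : IsSTorsion R M) :
    IsSTorsion R (ℕ →₀ M) := by
  intro x
  induction x using Finsupp.induction_linear with
  | zero => exact sSet_zero h
  | add a b ha hb => exact sSet_add ha hb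
  | single i m => exact sSet_map (Finsupp.lsingle i) (h m)

theorem isPureEmb_id {M : Type u} [AddCommGroup M] [Module R M] :
    IsPureEmb (LinearMap.id : M →ₗ[R] M) :=
  ⟨fun _ _ h => h, fun _ _ _ h => h⟩

theorem isPureEmb_comp {M N L : Type u} [AddCommGroup M] [Module R M]
    [AddCommGroup N] [Module R N] [AddCommGroup L] [Module R L]
    {f : M →ₗ[R] N} {g : N →ₗ[R] L} (hf : IsPureEmb f) (hg : IsPureEmb g) :
    IsPureEmb (g.comp f) :=
  ⟨hg.1.comp hf.1, fun k φ x h => hf.2 k φ x (hg.2 k φ _ h)⟩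

/-- A map that is a locally (eventually) retractable is a pure embedding. -/
theorem isPureEmb_of_eventually {A B : Type u} [AddCommGroup A] [Module R A]
    [AddCommGroup B] [Module R B] (ι : A →ₗ[R] B) {J : Type*} (l : Filter J) [l.NeBot]
    (r : J → B →ₗ[R] A) (hr : ∀ a, ∀ᶠ j in l, r j (ι a) = a) : IsPureEmb ι := by
  constructor
  · rw [injective_iff_map_eq_zero]
    intro a ha
    obtain ⟨j, hj⟩ := (hr a).exists
    rw [← hj, ha, map_zero]
  · intro k φ x hs
    have h : ∀ᶠ j in l, ∀ i, r j (ι (x i)) = x i := Filter.eventually_all.2 fun i => hr (x i)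
    obtain ⟨j, hj⟩ := h.exists
    have := ppSat_map (r j) hs
    have hx : ⇑(r j) ∘ ⇑ι ∘ x = x := funext hj
    rwa [hx] at this

/-- Purity of a map into a quotient. -/
theorem isPureEmb_mkQ {P Y M : Type u} [AddCommGroup P] [Module R P]
    [AddCommGroup Y] [Module R Y] [AddCommGroup M] [Module R M]
    (ι : P →ₗ[R] Y) (f : P →ₗ[R] M) (hf : IsPureEmb f) (K : Submodule R Y)
    {J : Type*} (l : Filter J) [l.NeBot] (r : J → Y →ₗ[R] M)
    (hr : ∀ j, (r j).comp ι = f) (hK : ∀ y ∈ K, ∀ᶠ j in l, r j y = 0) :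
    IsPureEmb (K.mkQ.comp ι) := by
  constructor
  · rw [injective_iff_map_eq_zero]
    intro p hp
    have hp' : ι p ∈ K := by simpa using hp
    obtain ⟨j, hj⟩ := (hK _ hp').exists
    apply hf.1
    rw [← hr j, map_zero]
    exact hj
  · rintro k φ x ⟨y, hy⟩
    choose z hz using fun j => K.mkQ_surjective (y j)
    have hmem : ∀ i, (∑ j, φ.coeffFree i j • ι (x j)) + (∑ j, φ.coeffExist i j • z j) ∈ K := by
      intro i
      rw [← Submodule.ker_mkQ K, LinearMap.mem_ker, ← hy i]
      simp only [map_add, map_sum, map_smul, hz, Function.comp, LinearMap.comp_apply]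
    have h : ∀ᶠ j in l, ∀ i, r j ((∑ j, φ.coeffFree i j • ι (x j)) +
        (∑ j, φ.coeffExist i j • z j)) = 0 :=
      Filter.eventually_all.2 fun i => hK _ (hmem i)
    obtain ⟨j, hj⟩ := h.exists
    apply hf.2
    refine ⟨fun i => r j (z i), fun i => ?_⟩
    rw [← hj i, ← hr j]
    simp only [map_add, map_sum, map_smul, Function.comp, LinearMap.comp_apply]

variable {M P : Type u} [AddCommGroup M] [Module R M] [AddCommGroup P] [Module R P]

/-- First Zorn step: an endomorphism over `P` generating a minimal left ideal. -/
theorem exists_minimal_endo (hM : IsKsTorPureInjective R M) (hP : IsSTorsion R P)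
    (ι : P →ₗ[R] M) (hι : IsPureEmb ι) :
    ∃ k : M →ₗ[R] M, k.comp ι = ι ∧ ∀ a : M →ₗ[R] M, a.comp ι = ι →
      ∃ b : M →ₗ[R] M, b.comp ι = ι ∧ b.comp (a.comp k) = k := by
  classical
  let S := {k : M →ₗ[R] M // k.comp ι = ι}
  let rel : S → S → Prop := fun x y => ∃ a : S, y.1 = a.1.comp x.1
  have htrans : ∀ {x y z : S}, rel x y → rel y z → rel x z := by
    rintro x y z ⟨a, ha⟩ ⟨b, hb⟩
    refine ⟨⟨b.1.comp a.1, ?_⟩, ?_⟩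
    · rw [LinearMap.comp_assoc, a.2, b.2]
    · rw [hb, ha, LinearMap.comp_assoc]
  have hrefl : ∀ x : S, rel x x := fun x => ⟨⟨LinearMap.id, rfl⟩, rfl⟩
  have hzorn : ∃ m : S, ∀ a, rel m a → rel a m := by
    refine exists_maximal_of_chains_bounded (r := rel) ?_ (fun {_ _ _} => htrans)
    intro c hc
    by_cases hne : c.Nonempty
    swap
    · exact ⟨⟨LinearMap.id, rfl⟩, fun a ha => (hne ⟨a, ha⟩).elim⟩
    let _ : Preorder c :=
      { le := fun x y => rel x.1 y.1
        le_refl := fun x => hrefl _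
        le_trans := fun x y z => htrans }
    have : Nonempty c := hne.to_subtype
    have : IsDirectedOrder c := ⟨fun x y => by
      by_cases hxy : x.1 = y.1
      · exact ⟨x, hrefl _, by rw [Subtype.ext hxy]⟩
      · rcases hc x.2 y.2 hxy with h | h
        · exact ⟨y, h, hrefl _⟩
        · exact ⟨x, hrefl _, h⟩⟩
    let t : c → c → (M →ₗ[R] M) := fun i j => if h : rel i.1 j.1 then h.choose.1 else 0
    have ht : ∀ i j : c, i ≤ j → j.1.1 = (t i j).comp i.1.1 := by
      intro i j h
      have h' : rel i.1 j.1 := h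
      have : t i j = h'.choose.1 := dif_pos h'
      rw [this]
      exact h'.choose_spec
    let q : c → M →ₗ[R] (M × (c →₀ M)) := fun i =>
      (LinearMap.inl R M (c →₀ M)) - (LinearMap.inr R M (c →₀ M)).comp
        ((Finsupp.lsingle i).comp i.1.1)
    let K : Submodule R (M × (c →₀ M)) := ⨆ i, LinearMap.range (q i)
    let r : c → (M × (c →₀ M)) →ₗ[R] M := fun j =>
      LinearMap.coprod j.1.1 (Finsupp.lsum ℕ (fun i => t i j))
    have hpure : IsPureEmb (K.mkQ.comp ((LinearMap.inl R M (c →₀ M)).comp ι)) := by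
      refine isPureEmb_mkQ _ ι hι K (Filter.atTop : Filter c) r ?_ ?_
      · intro j
        ext p
        have := LinearMap.congr_fun j.1.2 p
        simpa [r] using this
      · intro y hy
        refine Submodule.iSup_induction (fun i => LinearMap.range (q i))
          (motive := fun y => ∀ᶠ j in (Filter.atTop : Filter c), r j y = 0) hy ?_ ?_ ?_
        · rintro i _ ⟨m, rfl⟩
          filter_upwards [Filter.eventually_ge_atTop i] with j hj
          have := LinearMap.congr_fun (ht i j hj) m
          have e : q i m = (m, 0) - (0, Finsupp.single i (i.1.1 m)) := by simp [q]
          rw [e, map_sub, sub_eq_zero]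
          simp only [r, LinearMap.coprod_apply, map_zero, add_zero, zero_add,
            Finsupp.lsum_single]
          exact this
        · simp
        · intro y z hy hz
          filter_upwards [hy, hz] with j h1 h2
          rw [map_add, h1, h2, add_zero]
    have htor : IsSTorsion R ((M × (c →₀ M)) ⧸ K) :=
      isSTorsion_of_surjective (isSTorsion_prod hM.1 (isSTorsion_finsupp hM.1 c)) K.mkQ
        K.mkQ_surjective
    obtain ⟨H, hH⟩ := hM.2 _ _ hP htor _ hpure ι
    have hq : ∀ (i : c) (m : M), K.mkQ (m, 0) = K.mkQ (0, Finsupp.single i (i.1.1 m)) := by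
      intro i m
      have hmem : q i m ∈ K := Submodule.mem_iSup_of_mem i ⟨m, rfl⟩
      have : K.mkQ (q i m) = 0 := by simpa using hmem
      have e : q i m = (m, 0) - (0, Finsupp.single i (i.1.1 m)) := by simp [q]
      rw [e, map_sub, sub_eq_zero] at this
      exact this
    refine ⟨⟨(H.comp K.mkQ).comp (LinearMap.inl R M (c →₀ M)), ?_⟩, ?_⟩
    · rw [LinearMap.comp_assoc, LinearMap.comp_assoc]; exact hH
    · intro a ha
      let i : c := ⟨a, ha⟩
      refine ⟨⟨(H.comp K.mkQ).comp ((LinearMap.inr R M (c →₀ M)).comp (Finsupp.lsingle i)), ?_⟩, ?_⟩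
      · ext p
        have h1 := LinearMap.congr_fun hH p
        have h2 := LinearMap.congr_fun a.2 p
        have h3 := hq i (ι p)
        simp only [LinearMap.comp_apply, LinearMap.inl_apply, LinearMap.inr_apply,
          Finsupp.lsingle_apply] at h1 h2 ⊢
        have h4 : i.1.1 (ι p) = ι p := h2
        rw [h4] at h3
        rw [← h3, h1]
      · ext m
        have h3 := hq i m
        simp only [LinearMap.comp_apply, LinearMap.inl_apply, LinearMap.inr_apply,
          Finsupp.lsingle_apply]
        rw [h3]
  obtain ⟨m, hm⟩ := hzorn
  refine ⟨m.1, m.2, fun a ha => ?_⟩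
  obtain ⟨b, hb⟩ := hm ⟨a.comp m.1, by rw [LinearMap.comp_assoc, m.2, ha]⟩ ⟨⟨a, ha⟩, rfl⟩
  exact ⟨b.1, b.2, hb.symm⟩

/-- Second Zorn step: an idempotent. -/
theorem exists_minimal_idem (hM : IsKsTorPureInjective R M) (hP : IsSTorsion R P)
    (ι : P →ₗ[R] M) (hι : IsPureEmb ι) :
    ∃ e : M →ₗ[R] M, e.comp e = e ∧ e.comp ι = ι ∧ ∀ a : M →ₗ[R] M, a.comp ι = ι →
      ∃ b : M →ₗ[R] M, b.comp ι = ι ∧ b.comp (a.comp e) = e := by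
  obtain ⟨k, hk, hmin⟩ := exists_minimal_endo hM hP ι hι
  let T : Set (Submodule R M) := {E | LinearMap.range ι ≤ E ∧ ∃ b : M →ₗ[R] M, ∀ x ∈ E, b (k x) = x}
  have hT0 : LinearMap.range ι ∈ T := by
    refine ⟨le_rfl, LinearMap.id, ?_⟩
    rintro _ ⟨p, rfl⟩
    exact LinearMap.congr_fun hk p
  obtain ⟨E, -, hE⟩ := zorn_le_nonempty₀ T (by
    intro c hcT hc E₀ hE₀
    have hdir : DirectedOn (· ≤ ·) c := hc.directedOn
    have : Nonempty c := ⟨⟨E₀, hE₀⟩⟩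
    have : IsDirectedOrder c := ⟨fun x y => by
      rcases hc.total x.2 y.2 with h | h
      · exact ⟨y, h, le_rfl⟩
      · exact ⟨x, le_rfl, h⟩⟩
    choose b hb using fun i : c => (hcT i.2).2
    let q : ↥(sSup c) →ₗ[R] (M × M) := LinearMap.prod (k.comp (sSup c).subtype) (-(sSup c).subtype)
    let K : Submodule R (M × M) := LinearMap.range q
    have hpure : IsPureEmb (K.mkQ.comp (LinearMap.inr R M M)) := by
      refine isPureEmb_mkQ _ LinearMap.id isPureEmb_id K (Filter.atTop : Filter c)
        (fun i => LinearMap.coprod (b i) LinearMap.id) ?_ ?_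
      · intro j
        ext p
        simp
      · rintro _ ⟨⟨x, hx⟩, rfl⟩
        obtain ⟨E₁, hE₁, hxE⟩ := (Submodule.mem_sSup_of_directed ⟨E₀, hE₀⟩ hdir).1 hx
        filter_upwards [Filter.eventually_ge_atTop (⟨E₁, hE₁⟩ : c)] with j hj
        have : x ∈ j.1 := hj hxE
        simp [q, hb j x this]
    have htor : IsSTorsion R ((M × M) ⧸ K) :=
      isSTorsion_of_surjective (isSTorsion_prod hM.1 hM.1) K.mkQ K.mkQ_surjective
    obtain ⟨H, hH⟩ := hM.2 _ _ hM.1 htor _ hpure LinearMap.id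
    refine ⟨sSup c, ⟨(hcT hE₀).1.trans (le_sSup hE₀), (H.comp K.mkQ).comp (LinearMap.inl R M M), ?_⟩,
      fun z hz => le_sSup hz⟩
    intro x hx
    have hmem : q ⟨x, hx⟩ ∈ K := ⟨_, rfl⟩
    have h0 : K.mkQ (q ⟨x, hx⟩) = 0 := by simpa using hmem
    have e : q ⟨x, hx⟩ = (k x, 0) - (0, x) := by simp [q]
    rw [e, map_sub, sub_eq_zero] at h0
    have h1 := LinearMap.congr_fun hH x
    simp only [LinearMap.comp_apply, LinearMap.inl_apply, LinearMap.inr_apply,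
      LinearMap.id_apply] at h1 ⊢
    rw [h0, h1]) _ hT0
  obtain ⟨⟨hιE, b, hb⟩, hmax⟩ := hE
  have hbι : b.comp ι = ι := by
    ext p
    have h1 := hb (ι p) (hιE ⟨p, rfl⟩)
    have h2 : k (ι p) = ι p := LinearMap.congr_fun hk p
    rw [h2] at h1
    exact h1
  -- `b ∘ k` is the desired idempotent
  have hbkι : (b.comp k).comp ι = ι := by rw [LinearMap.comp_assoc, hk, hbι]
  have hEle : E ≤ LinearMap.range (b.comp k) := fun x hx => ⟨x, hb x hx⟩
  obtain ⟨d, hd, hdk⟩ := hmin ((b.comp k).comp b) (by rw [LinearMap.comp_assoc, hbι, hbkι])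
  have hrange : LinearMap.range (b.comp k) ≤ E := by
    refine hmax ⟨hιE.trans hEle, (b.comp d).comp b, ?_⟩ hEle
    rintro _ ⟨x, rfl⟩
    have := LinearMap.congr_fun hdk x
    simp only [LinearMap.comp_apply] at this ⊢
    rw [this]
  refine ⟨b.comp k, ?_, hbkι, ?_⟩
  · ext x
    exact hb _ (hrange ⟨x, rfl⟩)
  · intro a ha
    obtain ⟨d, hd, hdk⟩ := hmin (a.comp b) (by rw [LinearMap.comp_assoc, hbι, ha])
    refine ⟨b.comp d, by rw [LinearMap.comp_assoc, hd, hbι], ?_⟩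
    ext x
    have := LinearMap.congr_fun hdk x
    simp only [LinearMap.comp_apply] at this ⊢
    rw [this]

/-- Existence of an envelope of `P` inside `M`. -/
theorem exists_envelope (hM : IsKsTorPureInjective R M) (hP : IsSTorsion R P)
    (ι : P →ₗ[R] M) (hι : IsPureEmb ι) :
    ∃ e : M →ₗ[R] M, (∀ x, e (e x) = e x) ∧ (∀ p, e (ι p) = ι p) ∧
      ∀ a : LinearMap.range e →ₗ[R] LinearMap.range e,
        (∀ p (x : LinearMap.range e), x.1 = ι p → a x = x) → Function.Bijective a := by
  obtain ⟨e, hee, heι, hmin⟩ := exists_minimal_idem hM hP ι hι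
  have hee' : ∀ x, e (e x) = e x := fun x => LinearMap.congr_fun hee x
  have heι' : ∀ p, e (ι p) = ι p := fun p => LinearMap.congr_fun heι p
  have hfix : ∀ x : LinearMap.range e, e x.1 = x.1 := by
    rintro ⟨_, y, rfl⟩
    exact hee' y
  have hre : ∀ x : LinearMap.range e, e.rangeRestrict x.1 = x := fun x => Subtype.ext (hfix x)
  have key : ∀ a : LinearMap.range e →ₗ[R] LinearMap.range e,
      (∀ p (x : LinearMap.range e), x.1 = ι p → a x = x) →
      ∃ b : LinearMap.range e →ₗ[R] LinearMap.range e,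
        (∀ p (x : LinearMap.range e), x.1 = ι p → b x = x) ∧ ∀ x, b (a x) = x := by
    intro a ha
    obtain ⟨b, hb, hbe⟩ := hmin ((LinearMap.range e).subtype.comp (a.comp e.rangeRestrict)) (by
      ext p
      have h := ha p (e.rangeRestrict (ι p)) (heι' p)
      simp only [LinearMap.comp_apply]
      rw [h]
      exact heι' p)
    refine ⟨e.rangeRestrict.comp (b.comp (LinearMap.range e).subtype), ?_, ?_⟩
    · intro p x hx
      apply Subtype.ext
      have h1 : b (ι p) = ι p := LinearMap.congr_fun hb p
      change e (b x.1) = x.1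
      rw [hx, h1, heι']
    · intro x
      apply Subtype.ext
      have h1 := LinearMap.congr_fun hbe x.1
      simp only [LinearMap.comp_apply, hfix, hre, Submodule.subtype_apply] at h1
      change e (b (a x).1) = x.1
      rw [h1, hfix]
  refine ⟨e, hee', heι', fun a ha => ?_⟩
  obtain ⟨b, hb, hba⟩ := key a ha
  obtain ⟨d, -, hdb⟩ := key b hb
  refine ⟨Function.LeftInverse.injective hba, fun y => ⟨b y, ?_⟩⟩
  apply Function.LeftInverse.injective hdb
  rw [hba]

end KsTorAux

/-- **Corollary.** Assume `R` is right semihereditary and the class of `𝔰`-torsion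
modules is nontrivial.  Let `M`, `N` be `𝔰`-torsion `K^{𝔰-Tor}`-pure-injective
modules.  If there are pure embeddings `f : M → N` and `g : N → M`, then `M` and `N`
are isomorphic. -/
theorem iso_of_mutual_pureEmb_ksTorPureInjective (R : Type u) [Ring R]
    (hsh : RightSemihereditary R) (hnt : KsTorNontrivial R)
    (M N : Type u) [AddCommGroup M] [Module R M] [AddCommGroup N] [Module R N]
    (hM : IsSTorsion R M) (hN : IsSTorsion R N)
    (hMpi : IsKsTorPureInjective R M) (hNpi : IsKsTorPureInjective R N)
    (f : M →ₗ[R] N) (hf : IsPureEmb f) (g : N →ₗ[R] M) (hg : IsPureEmb g) :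
    Nonempty (M ≃ₗ[R] N) := by
  obtain ⟨g', hg'⟩ := hNpi.2 N M hN hM g hg LinearMap.id
  obtain ⟨f', hf'⟩ := hMpi.2 M N hM hN f hf LinearMap.id
  have hgg : ∀ x, g' (g x) = x := fun x => LinearMap.congr_fun hg' x
  have hff : ∀ x, f' (f x) = x := fun x => LinearMap.congr_fun hf' x
  let C : Submodule R M := LinearMap.ker g'
  have hC0 : ∀ c : C, g' c.1 = 0 := fun c => c.2
  let π : M →ₗ[R] C := LinearMap.codRestrict C (LinearMap.id - g.comp g') (fun x => by
    simp [C, hgg])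
  have hπ : ∀ x, ((π x : C) : M) = x - g (g' x) := fun x => rfl
  have hπg : ∀ x, π (g x) = 0 := fun x => Subtype.ext (by simp [hπ, hgg])
  have hπC : ∀ c : C, π c.1 = c := fun c => Subtype.ext (by simp [hπ, hC0])
  have hCtor : IsSTorsion R C := isSTorsion_of_surjective hM π (fun c => ⟨c.1, hπC c⟩)
  let h : Module.End R M := g.comp f
  let h' : Module.End R M := f'.comp g'
  have hh : ∀ x, h x = g (f x) := fun x => rfl
  have hh' : ∀ x, h' x = f' (g' x) := fun x => rfl
  have hhs : ∀ n x, (h ^ (n + 1)) x = g (f ((h ^ n) x)) := by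
    intro n x
    rw [pow_succ', Module.End.mul_apply, hh]
  have hhs' : ∀ n x, (h' ^ (n + 1)) x = (h' ^ n) (f' (g' x)) := by
    intro n x
    rw [pow_succ, Module.End.mul_apply, hh']
  have horth : ∀ (i j : ℕ) (c : C), π ((h' ^ i) ((h ^ j) c.1)) = if i = j then c else 0 := by
    intro i
    induction i with
    | zero =>
      intro j c
      cases j with
      | zero => simp [hπC]
      | succ j => rw [hhs]; simp [hπg]
    | succ i ih =>
      intro j c
      cases j with
      | zero => rw [hhs']; simp [hC0]
      | succ j => rw [hhs, hhs', hgg, hff, ih]; simp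
  let P := ℕ →₀ C
  have hP : IsSTorsion R P := isSTorsion_finsupp_nat hCtor
  let Θ : P →ₗ[R] M := Finsupp.lsum ℕ (fun n => (h ^ n).comp C.subtype)
  have hΘ : ∀ n (c : C), Θ (Finsupp.single n c) = (h ^ n) c.1 := by
    intro n c
    exact Finsupp.lsum_single _ _ _ _
  have hΘpure : IsPureEmb Θ := by
    refine isPureEmb_of_eventually Θ (Filter.atTop : Filter ℕ)
      (fun n => ∑ i ∈ Finset.range n, (Finsupp.lsingle i).comp (π.comp (h' ^ i))) ?_
    intro p
    induction p using Finsupp.induction_linear with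
    | zero => simp
    | add a b ha hb =>
      filter_upwards [ha, hb] with n h1 h2
      rw [map_add, map_add, h1, h2]
    | single j c =>
      filter_upwards [Filter.eventually_gt_atTop j] with n hn
      rw [hΘ, LinearMap.sum_apply, Finset.sum_eq_single j]
      · simp [horth]
      · intro i _ hij
        simp [horth, hij]
      · intro hj
        exact (hj (Finset.mem_range.2 hn)).elim
  obtain ⟨e, hee, heθ, henv⟩ := exists_envelope hNpi hP (f.comp Θ) (isPureEmb_comp hΘpure hf)
  have heθ' : ∀ p, e (f (Θ p)) = f (Θ p) := heθ
  have hfix : ∀ x : LinearMap.range e, e x.1 = x.1 := by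
    rintro ⟨_, y, rfl⟩
    exact hee y
  have hre : ∀ x : LinearMap.range e, e.rangeRestrict x.1 = x := fun x => Subtype.ext (hfix x)
  have hcoe : ∀ x, (e.rangeRestrict x).1 = e x := fun x => rfl
  have hreg : ∀ p, e (g' (Θ p)) = g' (Θ p) := by
    intro p
    induction p using Finsupp.induction_linear with
    | zero => simp
    | add a b ha hb => simp only [map_add, ha, hb]
    | single j c =>
      rw [hΘ]
      cases j with
      | zero => simp [hC0]
      | succ j => rw [hhs, hgg, ← hΘ, heθ']
  let v : (C × LinearMap.range e) →ₗ[R] LinearMap.range e :=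
    (e.rangeRestrict.comp f).comp
      (LinearMap.coprod C.subtype (g.comp (LinearMap.range e).subtype))
  let w : LinearMap.range e →ₗ[R] (C × LinearMap.range e) :=
    (LinearMap.prod π (e.rangeRestrict.comp g')).comp (f'.comp (LinearMap.range e).subtype)
  have hv : ∀ c x, v (c, x) = e.rangeRestrict (f (c.1 + g x.1)) := fun c x => rfl
  have hw : ∀ x, w x = (π (f' x.1), e.rangeRestrict (g' (f' x.1))) := fun x => rfl
  have hvτ : ∀ p, v (π (Θ p), e.rangeRestrict (g' (Θ p))) = e.rangeRestrict (f (Θ p)) := by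
    intro p
    rw [hv, hcoe, hreg, hπ, sub_add_cancel]
  have hwθ : ∀ p, w (e.rangeRestrict (f (Θ p))) = (π (Θ p), e.rangeRestrict (g' (Θ p))) := by
    intro p
    rw [hw, hcoe, heθ', hff]
  have hvw : Function.Bijective (v.comp w) := by
    apply henv
    intro p x hx
    have hx' : x = e.rangeRestrict (f (Θ p)) := by
      rw [← hre x, hx]; rfl
    rw [hx', LinearMap.comp_apply, hwθ, hvτ]
  have hA1 : ∀ c : C, w (v (c, 0)) = (c, 0) := by
    intro c
    have h1 := hvτ (Finsupp.single 0 c)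
    have h2 := hwθ (Finsupp.single 0 c)
    rw [← h1, hΘ] at h2
    simpa [hπC, hC0] using h2
  have hA2 : ∀ p, w (v (0, e.rangeRestrict (f (Θ p)))) = (0, e.rangeRestrict (f (Θ p))) := by
    intro p
    induction p using Finsupp.induction_linear with
    | zero => 
      have : ((0 : C), e.rangeRestrict (f (Θ 0))) = 0 := by simp
      rw [this, map_zero, map_zero]
    | add a b ha hb =>
      have : ((0 : C), e.rangeRestrict (f (Θ (a + b)))) =
          (0, e.rangeRestrict (f (Θ a))) + (0, e.rangeRestrict (f (Θ b))) := by
        simp only [map_add, Prod.mk_add_mk, add_zero]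
      rw [this, map_add, map_add, ha, hb]
    | single j c =>
      have h1 := hvτ (Finsupp.single (j + 1) c)
      have h2 := hwθ (Finsupp.single (j + 1) c)
      rw [← h1, hΘ, hhs, hπg, hgg, ← hΘ] at h2
      exact h2
  let A : (C × LinearMap.range e) →ₗ[R] (C × LinearMap.range e) := w.comp v
  let β : LinearMap.range e →ₗ[R] LinearMap.range e :=
    (LinearMap.snd R C (LinearMap.range e)).comp (A.comp (LinearMap.inr R C (LinearMap.range e)))
  have hβ : Function.Bijective β := by
    apply henv
    intro p x hx
    have hx' : x = e.rangeRestrict (f (Θ p)) := by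
      rw [← hre x, hx]; rfl
    rw [hx']
    exact congrArg Prod.snd (hA2 p)
  have hA : ∀ c x, A (c, x) = (c + (A (0, x)).1, β x) := by
    intro c x
    have h1 : ((c, x) : C × LinearMap.range e) = (c, 0) + (0, x) := by simp
    have h2 : A (c, 0) = (c, 0) := hA1 c
    rw [h1, map_add, h2]
    apply Prod.ext
    · rfl
    · exact zero_add _
  have hAsurj : Function.Injective A := by
    rw [injective_iff_map_eq_zero]
    rintro ⟨c, x⟩ hcx
    rw [hA] at hcx
    have hx : x = 0 := by
      apply hβ.1
      rw [map_zero]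
      exact congrArg Prod.snd hcx
    subst hx
    have h1 : c + (A (0, 0)).1 = 0 := congrArg Prod.fst hcx
    have h2 : A (0, 0) = 0 := map_zero A
    rw [h2] at h1
    have h3 : c = 0 := by simpa using h1
    rw [h3]
    rfl
  have hvbij : Function.Bijective v := by
    constructor
    · intro x y hxy
      apply hAsurj
      change w (v x) = w (v y)
      rw [hxy]
    · intro y
      obtain ⟨x, hx⟩ := hvw.2 y
      exact ⟨w x, hx⟩
  let ev : (C × LinearMap.range e) ≃ₗ[R] LinearMap.range e := LinearEquiv.ofBijective v hvbij
  -- assemble the isomorphism `M → N`: `m ↦ v (π m, e (g' m)) + (g' m - e (g' m))`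
  let s : M →ₗ[R] N :=
    (LinearMap.range e).subtype.comp (v.comp (LinearMap.prod π (e.rangeRestrict.comp g'))) +
      (g' - e.comp g')
  have hs : ∀ m, s m = (v (π m, e.rangeRestrict (g' m))).1 + (g' m - e (g' m)) := fun m => rfl
  have hes : ∀ m, e (s m) = (v (π m, e.rangeRestrict (g' m))).1 := by
    intro m
    rw [hs, map_add, hfix, map_sub, hee, sub_self, add_zero]
  refine ⟨LinearEquiv.ofBijective s ⟨?_, ?_⟩⟩
  · rw [injective_iff_map_eq_zero]
    intro m hm
    have h1 := hes m
    rw [hm, map_zero] at h1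
    have h2 : v (π m, e.rangeRestrict (g' m)) = 0 := Subtype.ext h1.symm
    have h3 := hs m
    rw [hm, h2] at h3
    have h4 : (π m, e.rangeRestrict (g' m)) = 0 := by
      apply hvbij.1
      rw [h2, map_zero]
    have h5 : π m = 0 := congrArg Prod.fst h4
    have h6 : e (g' m) = 0 := congrArg (fun z => (Prod.snd z).1) h4
    have h7 : g' m = 0 := by
      rw [h6] at h3
      simpa using h3.symm
    have h8 := hπ m
    rw [h5, h7] at h8
    simpa using h8.symm
  · intro n
    obtain ⟨⟨c, x⟩, hcx⟩ := hvbij.2 (e.rangeRestrict n)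
    refine ⟨c.1 + g (x.1 + (n - e n)), ?_⟩
    have h1 : g' (c.1 + g (x.1 + (n - e n))) = x.1 + (n - e n) := by
      rw [map_add, hC0, zero_add, hgg]
    have h2 : π (c.1 + g (x.1 + (n - e n))) = c := by
      rw [map_add, hπC, hπg, add_zero]
    have h3 : e (x.1 + (n - e n)) = x.1 := by
      rw [map_add, map_sub, hee, sub_self, add_zero, hfix]
    have h4 : e.rangeRestrict (x.1 + (n - e n)) = x := Subtype.ext h3
    rw [hs, h1, h2, h3, h4, hcx, hcoe]
    abel
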